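/- arXiv:2505.24056 — 8 statements merged into one kernel-verified Lean document; each statement's English description precedes it below -/
import Mathlib

section
/- Let T be the n×n real symmetric tridiagonal matrix with diagonal entries a_1,…,a_n and off-diagonal entries b_2,…,b_n. Then θ_n = det T, and if θ_n ≠ 0 the inverse of T has entries given, for 1 ≤ i ≤ j ≤ n, by (T^{-1})_{ij} = (−1)^{i+j} (∏_{k=i+1}^{j} b_k) θ_{i−1} φ_{j+1} / θ_n, and for i > j by (T^{-1})_{ij} = (−1)^{i+j} (∏_{k=j+1}^{i} b_k) θ_{j−1} φ_{i+1} / θ_n. -/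
/-- The tridiagonal matrix of size `m`. -/
noncomputable def triMat (a b : ℕ → ℝ) (m : ℕ) : Matrix (Fin m) (Fin m) ℝ := fun i j =>
  if (i : ℕ) = (j : ℕ) then a ((i : ℕ) + 1)
      else if (i : ℕ) + 1 = (j : ℕ) then b ((j : ℕ) + 1)
      else if (j : ℕ) + 1 = (i : ℕ) then b ((i : ℕ) + 1)
      else 0

theorem triMat_minor (a b : ℕ → ℝ) (m : ℕ) :
    ((triMat a b (m+2)).submatrix (Fin.last (m+1)).succAbove
      (Fin.castSucc (Fin.last m)).succAbove).det = b (m+2) * (triMat a b m).det := by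
  rw [Matrix.det_succ_column _ (Fin.last m), Fin.sum_univ_castSucc]
  have h1 : ∀ i : Fin m, triMat a b (m+2) i.castSucc.castSucc (Fin.last (m+1)) = 0 := by
    intro i
    have := i.isLt
    simp only [triMat, Fin.val_castSucc, Fin.val_last]
    rw [if_neg (by omega), if_neg (by omega), if_neg (by omega)]
  have h2 : triMat a b (m+2) (Fin.last m).castSucc (Fin.last (m+1)) = b (m+2) := by
    simp [triMat]
  have h3 : (Fin.castSucc (Fin.last m)).succAbove (Fin.last m) = Fin.last (m+1) := by
    rw [Fin.succAbove_castSucc_self]; simp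
  have h4 : (((triMat a b (m+2)).submatrix (Fin.last (m+1)).succAbove
      (Fin.castSucc (Fin.last m)).succAbove).submatrix (Fin.last m).succAbove
      (Fin.last m).succAbove) = triMat a b m := by
    ext i j
    have : (Fin.castSucc (Fin.last m)).succAbove (Fin.castSucc j) = j.castSucc.castSucc :=
      Fin.succAbove_of_castSucc_lt _ _ (by simp [Fin.lt_def])
    simp [Matrix.submatrix_apply, this, triMat]
  rw [h4]
  simp only [Matrix.submatrix_apply, h3, Fin.succAbove_last, h1, h2]
  have : ((-1:ℝ))^(m+m) = 1 := Even.neg_one_pow ⟨m, rfl⟩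
  simp [this]

theorem triMat_det (a b : ℕ → ℝ) (m : ℕ) :
    (triMat a b (m+2)).det =
      a (m+2) * (triMat a b (m+1)).det - b (m+2) ^ 2 * (triMat a b m).det := by
  rw [Matrix.det_succ_row _ (Fin.last (m+1)), Fin.sum_univ_castSucc, Fin.sum_univ_castSucc,
    triMat_minor]
  have h1 : ∀ i : Fin m, triMat a b (m+2) (Fin.last (m+1)) i.castSucc.castSucc = 0 := by
    intro i
    have := i.isLt
    simp only [triMat, Fin.val_castSucc, Fin.val_last]
    rw [if_neg (by omega), if_neg (by omega), if_neg (by omega)]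
  have h2 : triMat a b (m+2) (Fin.last (m+1)) (Fin.last m).castSucc = b (m+2) := by
    simp [triMat]
    intro; omega
  have h3 : triMat a b (m+2) (Fin.last (m+1)) (Fin.last (m+1)) = a (m+2) := by
    simp [triMat]
  have h4 : (triMat a b (m+2)).submatrix (Fin.last (m+1)).succAbove
      (Fin.last (m+1)).succAbove = triMat a b (m+1) := by
    ext i j
    simp [triMat]
  rw [h4]
  simp only [h1, h2, h3]
  have e1 : ((-1:ℝ))^(m+1+(m+1)) = 1 := Even.neg_one_pow ⟨m+1, rfl⟩
  have e2 : ((-1:ℝ))^(m+1+m) = -1 := Odd.neg_one_pow ⟨m, by ring⟩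
  simp [e1, e2]
  ring

theorem triMat_sum (a b : ℕ → ℝ) (n : ℕ) (i : Fin n) (f : ℕ → ℝ) :
    ∑ k : Fin n, triMat a b n i k * f k =
      a (i+1) * f i + (if (i:ℕ)+1 < n then b (i+2) * f (i+1) else 0)
        + (if 0 < (i:ℕ) then b (i+1) * f (i-1) else 0) := by
  have h : ∀ k : Fin n, triMat a b n i k * f k =
      (fun k : ℕ => (if k = (i:ℕ) then a (i+1) * f i else 0)
      + (if k = (i:ℕ)+1 then b (i+2) * f (i+1) else 0)
      + (if k = (i:ℕ) - 1 then (if 0 < (i:ℕ) then b (i+1) * f (i-1) else 0) else 0)) k := by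
    intro k
    obtain ⟨i, hi⟩ := i
    obtain ⟨k, hk⟩ := k
    simp only [triMat]
    rcases Nat.lt_trichotomy i k with h | h | h
    · by_cases h' : i + 1 = k
      · subst h'
        simp
        intro; omega
      · rw [if_neg (by omega), if_neg (by omega), if_neg (by omega), if_neg (by omega),
          if_neg (by omega), if_neg (by omega)]; simp
    · subst h
      simp
      intro; omega
    · by_cases h' : k + 1 = i
      · subst h'
        simp
        rw [if_neg (by omega), if_neg (by omega), zero_add]
      · rw [if_neg (by omega), if_neg (by omega), if_neg (by omega), if_neg (by omega),
          if_neg (by omega), if_neg (by omega)]; simp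
  rw [Finset.sum_congr rfl (fun k _ => h k), Fin.sum_univ_eq_sum_range (fun k : ℕ =>
      (if k = (i:ℕ) then a (i+1) * f i else 0)
      + (if k = (i:ℕ)+1 then b (i+2) * f (i+1) else 0)
      + (if k = (i:ℕ) - 1 then (if 0 < (i:ℕ) then b (i+1) * f (i-1) else 0) else 0)),
    Finset.sum_add_distrib,
    Finset.sum_add_distrib, Finset.sum_ite_eq', Finset.sum_ite_eq', Finset.sum_ite_eq']
  have := i.isLt
  simp only [Finset.mem_range]
  rw [if_pos this, if_pos (show (i:ℕ) - 1 < n by omega)]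

/-- Candidate entries of the inverse (up to the factor `1 / θ n`). -/
noncomputable def triInv (b θ φ : ℕ → ℝ) (k j : ℕ) : ℝ :=
  if k ≤ j then (-1 : ℝ) ^ (k + j) * (∏ l ∈ Finset.Icc (k + 2) (j + 1), b l) * θ k * φ (j + 2)
  else (-1 : ℝ) ^ (k + j) * (∏ l ∈ Finset.Icc (j + 2) (k + 1), b l) * θ j * φ (k + 2)

theorem prod_left (b : ℕ → ℝ) (k j : ℕ) (h : k < j) :
    ∏ l ∈ Finset.Icc (k + 2) (j + 1), b l = b (k+2) * ∏ l ∈ Finset.Icc (k + 1 + 2) (j + 1), b l := by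
  rw [← Finset.mul_prod_Ioc_eq_prod_Icc (by omega : k + 2 ≤ j + 1)]
  congr 2
  ext x
  simp only [Finset.mem_Ioc, Finset.mem_Icc]
  omega

theorem prod_right (b : ℕ → ℝ) (k j : ℕ) (h : k ≤ j) :
    ∏ l ∈ Finset.Icc (k + 2) (j + 1 + 1), b l =
      (∏ l ∈ Finset.Icc (k + 2) (j + 1), b l) * b (j+2) := by
  rw [Finset.prod_Icc_succ_top (by omega)]

theorem triInv_row (n : ℕ) (a b θ φ : ℕ → ℝ) (hθ0 : θ 0 = 1) (hθ1 : θ 1 = a 1)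
    (hA : ∀ i, i + 1 < n → θ (i+2) = a (i+2) * θ (i+1) - b (i+2) ^ 2 * θ i)
    (hφtop : φ (n + 1) = 1) (hφn : φ n = a n)
    (hB : ∀ i, i + 1 < n → φ (i+1) = a (i+1) * φ (i+2) - b (i+2) ^ 2 * φ (i+3))
    (i j : ℕ) (hi : i < n) (hj : j < n) :
    a (i+1) * triInv b θ φ i j + (if i+1 < n then b (i+2) * triInv b θ φ (i+1) j else 0)
        + (if 0 < i then b (i+1) * triInv b θ φ (i-1) j else 0) = if i = j then θ n else 0 := by
  have W : ∀ d i, i + 2 + d = n → θ (i+1) * φ (i+2) - b (i+2) ^ 2 * θ i * φ (i+3) = θ n := by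
    intro d
    induction d with
    | zero =>
      rintro i rfl
      rw [hφn, hφtop, hA i (by omega)]; ring
    | succ d ih =>
      intro i h
      rw [← ih (i+1) (by omega), hB (i+1) (by omega), hA i (by omega)]; ring
  have W' : ∀ i, i + 1 < n → θ (i+1) * φ (i+2) - b (i+2) ^ 2 * θ i * φ (i+3) = θ n :=
    fun i h => W (n - (i+2)) i (by omega)
  have sgn : ∀ j : ℕ, (-1:ℝ)^(j+j) = 1 := fun j => Even.neg_one_pow ⟨j, rfl⟩
  rcases Nat.lt_trichotomy i j with h | rfl | h
  · rw [if_neg h.ne, if_pos (by omega)]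
    have e1 : triInv b θ φ i j = (-1 : ℝ) ^ (i + j) * (b (i+2) * ∏ l ∈ Finset.Icc (i + 1 + 2) (j + 1), b l) * θ i * φ (j + 2) := by
      rw [triInv, if_pos h.le, prod_left b i j h]
    have e2 : triInv b θ φ (i+1) j = (-1 : ℝ) ^ (i + 1 + j) * (∏ l ∈ Finset.Icc (i + 1 + 2) (j + 1), b l) * θ (i+1) * φ (j + 2) := by
      rw [triInv, if_pos (by omega : i + 1 ≤ j)]
    rw [e1, e2]
    rcases i with _ | i
    · simp [hθ0, hθ1]; ring
    · have e3 : triInv b θ φ i j = (-1 : ℝ) ^ (i + j) * (b (i+2) * (b (i+3) *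
          ∏ l ∈ Finset.Icc (i + 1 + 1 + 2) (j + 1), b l)) * θ i * φ (j + 2) := by
        rw [triInv, if_pos (by omega), prod_left b i j (by omega), prod_left b (i+1) j (by omega)]
      rw [if_pos (by omega), Nat.add_sub_cancel, e3, hA i (by omega)]
      ring
  · rw [if_pos rfl]
    have e1 : triInv b θ φ i i = θ i * φ (i + 2) := by
      rw [triInv, if_pos le_rfl, sgn]; simp
    have e2 : triInv b θ φ (i+1) i = - b (i+2) * θ i * φ (i + 3) := by
      rw [triInv, if_neg (by omega), show i + 1 + i = i + i + 1 by ring, pow_succ, sgn]; simp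
    have key : θ (i+1) * φ (i+2) - (if i + 1 < n then b (i+2) ^ 2 * θ i * φ (i+3) else 0) = θ n := by
      split_ifs with h
      · exact W' i h
      · obtain rfl : n = i + 1 := by omega
        rw [hφtop]; ring
    rw [← key, e1, e2]
    rcases i with _ | i
    · simp only [lt_irrefl, if_false, hθ0, hθ1]
      split_ifs <;> ring_nf
    · have e3 : triInv b θ φ i (i+1) = - b (i+2) * θ i * φ (i + 3) := by
        rw [triInv, if_pos (by omega), show i + (i + 1) = i + i + 1 by ring, pow_succ, sgn]; simp
      rw [Nat.add_sub_cancel, e3, hA i (by omega), if_pos (by omega : 0 < i + 1)]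
      split_ifs <;> ring
  · rw [if_neg h.ne', if_pos (by omega : 0 < i)]
    obtain ⟨i, rfl⟩ : ∃ m, i = m + 1 := ⟨i - 1, by omega⟩
    rw [Nat.add_sub_cancel]
    have e0 : triInv b θ φ i j = (-1 : ℝ) ^ (i + j) * (∏ l ∈ Finset.Icc (j + 2) (i + 1), b l) * θ j * φ (i + 2) := by
      rw [triInv]
      split_ifs with h'
      · obtain rfl : i = j := by omega
        rfl
      · rfl
    have e1 : triInv b θ φ (i+1) j = (-1 : ℝ) ^ (i + 1 + j) * ((∏ l ∈ Finset.Icc (j + 2) (i + 1), b l) * b (i+2)) * θ j * φ (i + 3) := by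
      rw [triInv, if_neg (by omega), prod_right b j i (by omega)]
    have e2 : triInv b θ φ (i+1+1) j = (-1 : ℝ) ^ (i + 1 + 1 + j) * ((∏ l ∈ Finset.Icc (j + 2) (i + 1), b l) * b (i+2) * b (i+3)) * θ j * φ (i + 4) := by
      rw [triInv, if_neg (by omega), prod_right b j (i+1) (by omega), prod_right b j i (by omega)]
    rw [e0, e1, e2]
    generalize ∏ l ∈ Finset.Icc (j + 2) (i + 1), b l = P
    split_ifs with h'
    · rw [hB (i+1) (by omega)]; ring
    · obtain rfl : n = i + 1 + 1 := by omega
      rw [hφn, hφtop]; ring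

/-- entries of the inverse of a real symmetric tridiagonal matrix. -/
theorem stmt_0 (n : ℕ) (hn : 1 ≤ n) (a b : ℕ → ℝ)
    (T : Matrix (Fin n) (Fin n) ℝ)
    (hT : ∀ i j : Fin n, T i j =
      if (i : ℕ) = (j : ℕ) then a ((i : ℕ) + 1)
      else if (i : ℕ) + 1 = (j : ℕ) then b ((j : ℕ) + 1)
      else if (j : ℕ) + 1 = (i : ℕ) then b ((i : ℕ) + 1)
      else 0)
    (θ : ℕ → ℝ) (hθ0 : θ 0 = 1) (hθ1 : θ 1 = a 1)
    (hθ : ∀ ℓ, 2 ≤ ℓ → ℓ ≤ n → θ ℓ = a ℓ * θ (ℓ - 1) - (b ℓ) ^ 2 * θ (ℓ - 2))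
    (φ : ℕ → ℝ) (hφtop : φ (n + 1) = 1) (hφn : φ n = a n)
    (hφ : ∀ ℓ, 1 ≤ ℓ → ℓ ≤ n - 1 → φ ℓ = a ℓ * φ (ℓ + 1) - (b (ℓ + 1)) ^ 2 * φ (ℓ + 2)) :
    θ n = T.det ∧
    (θ n ≠ 0 →
      ∀ i j : Fin n,
        ((i : ℕ) ≤ (j : ℕ) → T⁻¹ i j =
          (-1 : ℝ) ^ ((i : ℕ) + (j : ℕ)) *
            (∏ k ∈ Finset.Icc ((i : ℕ) + 2) ((j : ℕ) + 1), b k) *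
            θ (i : ℕ) * φ ((j : ℕ) + 2) / θ n) ∧
        ((j : ℕ) < (i : ℕ) → T⁻¹ i j =
          (-1 : ℝ) ^ ((i : ℕ) + (j : ℕ)) *
            (∏ k ∈ Finset.Icc ((j : ℕ) + 2) ((i : ℕ) + 1), b k) *
            θ (j : ℕ) * φ ((i : ℕ) + 2) / θ n)) := by
  obtain rfl : T = triMat a b n := by
    ext i j
    exact hT i j
  have hA : ∀ i, i + 1 < n → θ (i+2) = a (i+2) * θ (i+1) - b (i+2) ^ 2 * θ i :=
    fun i h => hθ (i+2) (by omega) (by omega)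
  have hB : ∀ i, i + 1 < n → φ (i+1) = a (i+1) * φ (i+2) - b (i+2) ^ 2 * φ (i+3) :=
    fun i h => hφ (i+1) (by omega) (by omega)
  have hdet : ∀ m, (m ≤ n → θ m = (triMat a b m).det) ∧
      (m + 1 ≤ n → θ (m+1) = (triMat a b (m+1)).det) := by
    intro m
    induction m with
    | zero => exact ⟨fun _ => by simp [hθ0], fun _ => by simp [hθ1, triMat]⟩
    | succ m ih =>
      refine ⟨ih.2, fun h => ?_⟩
      rw [triMat_det, hA m (by omega), ih.1 (by omega), ih.2 (by omega)]
  refine ⟨(hdet n).1 le_rfl, fun hne => ?_⟩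
  have hinv : (triMat a b n)⁻¹ = Matrix.of (fun i j : Fin n => triInv b θ φ i j / θ n) := by
    apply Matrix.inv_eq_right_inv
    ext i j
    have h1 := triMat_sum a b n i (fun k => triInv b θ φ k j / θ n)
    have h2 := triInv_row n a b θ φ hθ0 hθ1 hA hφtop hφn hB i j i.isLt j.isLt
    rw [Matrix.mul_apply]
    simp only [Matrix.of_apply]
    rw [h1]
    have h3 : (1 : Matrix (Fin n) (Fin n) ℝ) i j = (if (i:ℕ) = j then θ n else 0) / θ n := by
      rw [Matrix.one_apply]
      simp only [Fin.ext_iff]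
      split_ifs
      · field_simp
      · simp
    rw [h3, ← h2]
    split_ifs <;> ring
  intro i j
  rw [hinv]
  refine ⟨fun h => ?_, fun h => ?_⟩
  · simp only [triInv, Matrix.of_apply]
    rw [if_pos h]
  · simp only [triInv, Matrix.of_apply]
    rw [if_neg (by omega)]
end

section
/- Let T be the n×n real symmetric tridiagonal matrix with diagonal entries a_1,…,a_n and off-diagonal entries b_2,…,b_n, suppose θ_n = det T ≠ 0, and let β ∈ ℝ. Then the unique solution z ∈ ℝ^n of the linear system T z = β e_1 (where e_1 is the first standard basis vector) has components z_i = (−1)^{i+1} β (∏_{k=2}^{i} b_k) φ_{i+1} / θ_n for 1 ≤ i ≤ n. -/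
/-- Row sums of a tridiagonal array, applied to a sequence vanishing at `n`. -/
theorem tri_row (n : ℕ) (a b W : ℕ → ℝ) (hW : W n = 0) (i : ℕ) (hi : i < n) :
    ∑ j ∈ Finset.range n, (if i = j then a (i + 1)
      else if i + 1 = j then b (j + 1)
      else if j + 1 = i then b (i + 1)
      else 0) * W j = a (i + 1) * W i + b (i + 2) * W (i + 1)
        + (if i = 0 then 0 else b (i + 1) * W (i - 1)) := by
  have h : ∀ j ∈ Finset.range n, (if i = j then a (i + 1)
      else if i + 1 = j then b (j + 1)
      else if j + 1 = i then b (i + 1)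
      else 0) * W j = (if i = j then a (i + 1) * W i else 0)
        + (if i + 1 = j then b (i + 2) * W (i + 1) else 0)
        + (if i - 1 = j then (if i = 0 then 0 else b (i + 1) * W (i - 1)) else 0) := by
    intro j _
    by_cases h1 : i = j
    · subst h1
      have : i - 1 = i → i = 0 := by omega
      by_cases h0 : i = 0
      · simp [h0]
      · have : i - 1 ≠ i := by omega
        simp [this]
    · by_cases h2 : i + 1 = j
      · subst h2
        have : i - 1 ≠ i + 1 := by omega
        simp [this]
      · by_cases h3 : j + 1 = i
        · subst h3
          simp [h2]
        · by_cases h0 : i = 0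
          · subst h0
            simp only [if_neg h1, if_neg h2, if_neg h3]
            simp
          · have : i - 1 ≠ j := by omega
            simp [h1, h2, h3, this]
  rw [Finset.sum_congr rfl h, Finset.sum_add_distrib, Finset.sum_add_distrib,
    Finset.sum_ite_eq, Finset.sum_ite_eq, Finset.sum_ite_eq]
  have e1 : i ∈ Finset.range n := Finset.mem_range.2 hi
  have e2 : i - 1 ∈ Finset.range n := Finset.mem_range.2 (by omega)
  rw [if_pos e1, if_pos e2]
  by_cases h : i + 1 < n
  · rw [if_pos (Finset.mem_range.2 h)]
  · have : i + 1 = n := by omega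
    simp [this, hW]

/-- components of the solution of `T z = β e₁` for a symmetric tridiagonal `T`. -/
theorem stmt_1 (n : ℕ) (hn : 1 ≤ n) (a b : ℕ → ℝ)
    (T : Matrix (Fin n) (Fin n) ℝ)
    (hT : ∀ i j : Fin n, T i j =
      if (i : ℕ) = (j : ℕ) then a ((i : ℕ) + 1)
      else if (i : ℕ) + 1 = (j : ℕ) then b ((j : ℕ) + 1)
      else if (j : ℕ) + 1 = (i : ℕ) then b ((i : ℕ) + 1)
      else 0)
    (θ : ℕ → ℝ) (hθ0 : θ 0 = 1) (hθ1 : θ 1 = a 1)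
    (hθ : ∀ ℓ, 2 ≤ ℓ → ℓ ≤ n → θ ℓ = a ℓ * θ (ℓ - 1) - (b ℓ) ^ 2 * θ (ℓ - 2))
    (φ : ℕ → ℝ) (hφtop : φ (n + 1) = 1) (hφn : φ n = a n)
    (hφ : ∀ ℓ, 1 ≤ ℓ → ℓ ≤ n - 1 → φ ℓ = a ℓ * φ (ℓ + 1) - (b (ℓ + 1)) ^ 2 * φ (ℓ + 2))
    (hdet : θ n = T.det) (hne : θ n ≠ 0) (β : ℝ)
    (z : Fin n → ℝ)
    (hz : T.mulVec z = β • (Pi.single (⟨0, by omega⟩ : Fin n) (1 : ℝ) : Fin n → ℝ)) :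
    ∀ i : Fin n, z i =
      (-1 : ℝ) ^ (i : ℕ) * β * (∏ k ∈ Finset.Icc 2 ((i : ℕ) + 1), b k) *
        φ ((i : ℕ) + 2) / θ n := by
  obtain ⟨ψ, hψ⟩ : ∃ ψ : ℕ → ℝ, ∀ j, ψ j = if j ≤ n + 1 then φ j else 0 := ⟨_, fun _ => rfl⟩
  have ψle : ∀ j, j ≤ n + 1 → ψ j = φ j := fun j hj => by rw [hψ, if_pos hj]
  have ψtop : ψ (n + 2) = 0 := by rw [hψ, if_neg (by omega)]
  have ψrec : ∀ l, 1 ≤ l → l ≤ n → ψ l = a l * ψ (l + 1) - (b (l + 1)) ^ 2 * ψ (l + 2) := by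
    intro l h1 h2
    by_cases h : l = n
    · subst h
      rw [ψtop, ψle _ (by omega), ψle _ (by omega), hφn, hφtop]; ring
    · rw [ψle _ (by omega), ψle _ (by omega), ψle _ (by omega)]
      exact hφ l h1 (by omega)
  have inv : ∀ l, l + 1 ≤ n →
      θ (l + 1) * ψ (l + 2) - (b (l + 2)) ^ 2 * θ l * ψ (l + 3) = ψ 1 := by
    intro l
    induction l with
    | zero =>
      intro h
      rw [ψrec 1 le_rfl h, hθ0, hθ1]; norm_num
    | succ l ih =>
      intro h
      rw [← ih (by omega), hθ (l + 1 + 1) (by omega) h, ψrec (l + 2) (by omega) (by omega)]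
      simp only [Nat.add_sub_cancel, show l + 1 + 1 - 2 = l by omega]
      ring_nf
  have hθψ : ψ 1 = θ n := by
    obtain ⟨m, rfl⟩ : ∃ m, n = m + 1 := ⟨n - 1, by omega⟩
    have := inv m le_rfl
    rw [ψtop, ψle (m + 2) (by omega), hφtop] at this
    linarith
  obtain ⟨W, hW⟩ : ∃ W : ℕ → ℝ, ∀ j, W j =
      (-1 : ℝ) ^ j * β * (∏ k ∈ Finset.Icc 2 (j + 1), b k) * ψ (j + 2) / θ n :=
    ⟨_, fun _ => rfl⟩
  have hP : ∀ j, ∏ k ∈ Finset.Icc 2 (j + 1 + 1), b k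
      = (∏ k ∈ Finset.Icc 2 (j + 1), b k) * b (j + 2) := by
    intro j
    rw [Finset.prod_Icc_succ_top (by omega)]
  have hw : T.mulVec (fun i : Fin n => W i)
      = β • (Pi.single (⟨0, by omega⟩ : Fin n) (1 : ℝ) : Fin n → ℝ) := by
    funext i
    have key := tri_row n a b W (by rw [hW, ψtop]; simp) i i.2
    rw [← Fin.sum_univ_eq_sum_range (fun j => (if (i : ℕ) = j then a ((i : ℕ) + 1)
      else if (i : ℕ) + 1 = j then b (j + 1)
      else if j + 1 = (i : ℕ) then b ((i : ℕ) + 1)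
      else 0) * W j)] at key
    simp only [Matrix.mulVec, dotProduct, hT]
    rw [key]
    obtain ⟨i, hi⟩ := i
    rcases i with _ | i
    · have := ψrec 1 le_rfl hn
      rw [hθψ] at this
      simp only [hW, hP]
      simp
      field_simp
      rw [this]; ring
    · have := ψrec (i + 2) (by omega) (by omega)
      simp only [hW, hP, Nat.add_sub_cancel]
      rw [this]
      simp [Pi.single_apply]
      field_simp
      ring
  have hinj := Matrix.mulVec_injective_of_isUnit
    ((Matrix.isUnit_iff_isUnit_det T).2 (isUnit_iff_ne_zero.2 (hdet ▸ hne)))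
  have hzw : z = fun i : Fin n => W i := hinj (hz.trans hw.symm)
  intro i
  rw [hzw]
  simp only [hW]
  rw [ψle _ (by omega)]
end

section
/- Let T be the n×n real symmetric tridiagonal matrix with diagonal entries a_1,…,a_n and off-diagonal entries b_2,…,b_n, let c ∈ ℝ with det(T + cI) ≠ 0, and let β ∈ ℝ. Then the unique solution z^{(c)} ∈ ℝ^n of the linear system (T + cI) z^{(c)} = β e_1 has components z^{(c)}_i = (−1)^{i+1} β (∏_{k=2}^{i} b_k) (φ_{i+1} + h_{i+1}(c)) / (θ_n + g_n(c)) for 1 ≤ i ≤ n. -/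
/-- tridiagonal entries -/
noncomputable def triF (A b : ℕ → ℝ) (i j : ℕ) : ℝ :=
  (if i = j then A (i + 1) else 0) + (if i + 1 = j then b (i + 2) else 0) +
    (if j + 1 = i then b (i + 1) else 0)

theorem triF_det (A b Φ : ℕ → ℝ) (n : ℕ) (h1 : Φ (n + 1) = 1) (h2 : Φ n = A n)
    (h3 : ∀ l, 1 ≤ l → l + 1 ≤ n → Φ l = A l * Φ (l + 1) - b (l + 1) ^ 2 * Φ (l + 2)) :
    ∀ m s : ℕ, s + m = n →
      (Matrix.of fun i j : Fin m => triF A b (s + i) (s + j)).det = Φ (s + 1) := by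
  intro m
  induction m using Nat.strong_induction_on with
  | _ m ih =>
    intro s hs
    match m, ih, hs with
    | 0, _, hs => 
      have : s = n := by omega
      subst this
      simp [h1]
    | 1, _, hs =>
      have : s + 1 = n := by omega
      subst this
      simp [triF, h2]
    | m + 2, ih, hs =>
      have e1 := ih (m + 1) (by omega) (s + 1) (by omega)
      have e2 := ih m (by omega) (s + 2) (by omega)
      rw [h3 (s + 1) (by omega) (by omega)]
      rw [Matrix.det_succ_row_zero, Fin.sum_univ_succ, Fin.sum_univ_succ]
      rw [Finset.sum_eq_zero]
      · have m1 : ((Matrix.of fun i j : Fin (m + 2) => triF A b (s + i) (s + j)).submatrix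
            Fin.succ (Fin.succAbove 0)).det = Φ (s + 1 + 1) := by
          rw [← e1]
          congr 1
          ext i j
          simp only [Matrix.submatrix_apply, Matrix.of_apply, Fin.zero_succAbove, Fin.val_succ]
          congr 1 <;> omega
        have m2 : ((Matrix.of fun i j : Fin (m + 2) => triF A b (s + i) (s + j)).submatrix
            Fin.succ (Fin.succAbove (Fin.succ 0))).det = b (s + 2) * Φ (s + 2 + 1) := by
          rw [← e2, Matrix.det_succ_column_zero, Fin.sum_univ_succ, Finset.sum_eq_zero]
          · have m3 : (((Matrix.of fun i j : Fin (m + 2) => triF A b (s + i) (s + j)).submatrix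
                Fin.succ (Fin.succAbove (Fin.succ 0))).submatrix (Fin.succAbove 0) Fin.succ) =
                (Matrix.of fun i j : Fin m => triF A b (s + 2 + i) (s + 2 + j)) := by
              ext i j
              simp only [Matrix.submatrix_apply, Matrix.of_apply, Fin.zero_succAbove, Fin.val_succ,
                Fin.succ_succAbove_succ]
              congr 1 <;> omega
            rw [m3]
            have q : ¬ (s + 1 + 1 = s) := by omega
            simp [triF, Fin.succAbove, q]
          · intro i _
            have : (Matrix.of fun i j : Fin (m + 2) => triF A b (s + i) (s + j)).submatrix
                Fin.succ (Fin.succAbove (Fin.succ 0)) i.succ 0 = 0 := by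
              simp [triF, Fin.succAbove]
              omega
            rw [this]; simp
        rw [m1, m2]
        have q : ¬ (s + 1 + 1 = s) := by omega
        simp [triF, q]
        ring
      · intro i _
        have : (Matrix.of fun i j : Fin (m + 2) => triF A b (s + i) (s + j)) 0 i.succ.succ = 0 := by
          simp [triF]
          omega
        rw [this]; simp

theorem triF_sum (A b Y : ℕ → ℝ) (n i : ℕ) (hi : i < n) :
    ∑ j : Fin n, triF A b i j * Y j = A (i + 1) * Y i +
      (if i + 1 < n then b (i + 2) * Y (i + 1) else 0) +
      (if 1 ≤ i then b (i + 1) * Y (i - 1) else 0) := by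
  rw [Fin.sum_univ_eq_sum_range (fun j => triF A b i j * Y j) n]
  simp only [triF, add_mul, Finset.sum_add_distrib, ite_mul, zero_mul]
  congr 1
  · congr 1
    · simp [hi]
    · simp
  · rcases i with _ | k
    · simp
    · have : k < n := by omega
      simp [this]

theorem cont_eq (A b Θ Φ : ℕ → ℝ) (n : ℕ) (hn : 1 ≤ n) (h1 : Φ (n + 1) = 1) (h2 : Φ n = A n)
    (h3 : ∀ l, 1 ≤ l → l + 1 ≤ n → Φ l = A l * Φ (l + 1) - b (l + 1) ^ 2 * Φ (l + 2))
    (t0 : Θ 0 = 1) (t1 : Θ 1 = A 1)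
    (t : ∀ l, l + 2 ≤ n → Θ (l + 2) = A (l + 2) * Θ (l + 1) - b (l + 2) ^ 2 * Θ l) :
    Φ 1 = Θ n := by
  have key : ∀ l, l + 2 ≤ n → Φ 1 = Θ (l + 1) * Φ (l + 2) - b (l + 2) ^ 2 * Θ l * Φ (l + 3) := by
    intro l
    induction l with
    | zero => intro hl; rw [h3 1 le_rfl hl, t1, t0]; ring
    | succ k ih =>
      intro hl
      rw [ih (by omega), h3 (k + 2) (by omega) (by omega), t k (by omega)]; ring
  rcases n with _ | _ | k
  · omega
  · rw [h2, t1]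
  · rw [key k le_rfl, t k le_rfl, h2, h1]; ring

/-- components of the solution of the shifted system `(T + cI) z = β e₁`. -/
theorem stmt_4 (n : ℕ) (hn : 1 ≤ n) (a b : ℕ → ℝ) (c : ℝ)
    (T : Matrix (Fin n) (Fin n) ℝ)
    (hT : ∀ i j : Fin n, T i j =
      if (i : ℕ) = (j : ℕ) then a ((i : ℕ) + 1)
      else if (i : ℕ) + 1 = (j : ℕ) then b ((j : ℕ) + 1)
      else if (j : ℕ) + 1 = (i : ℕ) then b ((i : ℕ) + 1)
      else 0)
    (θ : ℕ → ℝ) (hθ0 : θ 0 = 1) (hθ1 : θ 1 = a 1)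
    (hθ : ∀ ℓ, 2 ≤ ℓ → ℓ ≤ n → θ ℓ = a ℓ * θ (ℓ - 1) - (b ℓ) ^ 2 * θ (ℓ - 2))
    (φ : ℕ → ℝ) (hφtop : φ (n + 1) = 1) (hφn : φ n = a n)
    (hφ : ∀ ℓ, 1 ≤ ℓ → ℓ ≤ n - 1 → φ ℓ = a ℓ * φ (ℓ + 1) - (b (ℓ + 1)) ^ 2 * φ (ℓ + 2))
    (g : ℕ → ℝ) (hg0 : g 0 = 0) (hg1 : g 1 = c)
    (hg : ∀ ℓ, 2 ≤ ℓ → ℓ ≤ n →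
      g ℓ = (a ℓ + c) * g (ℓ - 1) - (b ℓ) ^ 2 * g (ℓ - 2) + c * θ (ℓ - 1))
    (h : ℕ → ℝ) (hhtop : h (n + 1) = 0) (hhn : h n = c)
    (hh : ∀ ℓ, 1 ≤ ℓ → ℓ ≤ n - 1 →
      h ℓ = (a ℓ + c) * h (ℓ + 1) - (b (ℓ + 1)) ^ 2 * h (ℓ + 2) + c * φ (ℓ + 1))
    (hdet : (T + c • (1 : Matrix (Fin n) (Fin n) ℝ)).det ≠ 0) (β : ℝ)
    (z : Fin n → ℝ)
    (hz : (T + c • (1 : Matrix (Fin n) (Fin n) ℝ)).mulVec z =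
      β • (Pi.single (⟨0, by omega⟩ : Fin n) (1 : ℝ) : Fin n → ℝ)) :
    ∀ i : Fin n, z i =
      (-1 : ℝ) ^ (i : ℕ) * β * (∏ k ∈ Finset.Icc 2 ((i : ℕ) + 1), b k) *
        (φ ((i : ℕ) + 2) + h ((i : ℕ) + 2)) / (θ n + g n) := by
  have hA : ∀ i j : Fin n, (T + c • (1 : Matrix (Fin n) (Fin n) ℝ)) i j =
      triF (fun k => a k + c) b i j := by
    intro i j
    rw [Matrix.add_apply, hT, Matrix.smul_apply, Matrix.one_apply]
    simp only [triF, Fin.ext_iff]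
    by_cases h1 : (i : ℕ) = j
    · simp [h1]
    · by_cases h2 : (i : ℕ) + 1 = j
      · have h3 : ¬ ((j : ℕ) + 1 = i) := by omega
        simp [← h2]
        omega
      · by_cases h3 : (j : ℕ) + 1 = i
        · simp [h1, h2, h3]
        · simp [h1, h2, h3]
  have p1 : φ (n + 1) + h (n + 1) = 1 := by rw [hφtop, hhtop]; ring
  have p2 : φ n + h n = a n + c := by rw [hφn, hhn]
  have p3 : ∀ l, 1 ≤ l → l + 1 ≤ n → φ l + h l = (a l + c) * (φ (l + 1) + h (l + 1))
      - b (l + 1) ^ 2 * (φ (l + 2) + h (l + 2)) := by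
    intro l h1 h2
    rw [hφ l h1 (by omega), hh l h1 (by omega)]; ring
  have hdet1 := triF_det (fun k => a k + c) b (fun k => φ k + h k) n p1 p2 p3 n 0 (by omega)
  have hΘ := cont_eq (fun k => a k + c) b (fun k => θ k + g k) (fun k => φ k + h k) n hn p1 p2 p3
    (by simp [hθ0, hg0]) (by simp [hθ1, hg1]) (by
      intro l hl
      have e1 := hθ (l + 2) (by omega) hl
      have e2 := hg (l + 2) (by omega) hl
      simp only [show l + 2 - 1 = l + 1 by omega, show l + 2 - 2 = l by omega] at e1 e2
      simp only [e1, e2]; ring)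
  have hM : (Matrix.of fun i j : Fin n => triF (fun k => a k + c) b (0 + i) (0 + j)) =
      T + c • (1 : Matrix (Fin n) (Fin n) ℝ) := by
    ext i j; rw [hA]; simp
  rw [hM] at hdet1
  simp only [zero_add] at hdet1 hΘ
  have hne : θ n + g n ≠ 0 := by rw [← hΘ, ← hdet1]; exact hdet
  obtain ⟨Y, hY⟩ : ∃ Y : ℕ → ℝ, ∀ k, Y k = (-1 : ℝ) ^ k * β *
      (∏ k ∈ Finset.Icc 2 (k + 1), b k) * (φ (k + 2) + h (k + 2)) / (θ n + g n) :=
    ⟨_, fun _ => rfl⟩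
  have hsol : (T + c • (1 : Matrix (Fin n) (Fin n) ℝ)).mulVec (fun i : Fin n => Y i) =
      β • (Pi.single (⟨0, by omega⟩ : Fin n) (1 : ℝ) : Fin n → ℝ) := by
    ext i
    obtain ⟨i, hi⟩ := i
    simp only [Matrix.mulVec, dotProduct, hA]
    rw [triF_sum _ _ Y n i hi]
    have hprod : ∀ k, ∏ k ∈ Finset.Icc 2 (k + 1 + 1), b k =
        (∏ k ∈ Finset.Icc 2 (k + 1), b k) * b (k + 2) := by
      intro k
      rw [Finset.prod_Icc_succ_top (by omega)]
    have main : (a (i + 1) + c) * (φ (i + 2) + h (i + 2)) =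
        (φ (i + 1) + h (i + 1)) +
          (if i + 1 < n then b (i + 2) ^ 2 * (φ (i + 3) + h (i + 3)) else 0) := by
      split_ifs with h1
      · rw [p3 (i + 1) (by omega) (by omega)]; ring
      · have : n = i + 1 := by omega
        subst this
        rw [p1, p2]; ring
    have up : (if i + 1 < n then b (i + 2) * Y (i + 1) else 0) =
        - ((-1 : ℝ) ^ i * β * (∏ k ∈ Finset.Icc 2 (i + 1), b k) / (θ n + g n) *
          (if i + 1 < n then b (i + 2) ^ 2 * (φ (i + 3) + h (i + 3)) else 0)) := by
      split_ifs
      · rw [hY, hprod]; ring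
      · ring
    have mid : (a (i + 1) + c) * Y i = (-1 : ℝ) ^ i * β * (∏ k ∈ Finset.Icc 2 (i + 1), b k) /
        (θ n + g n) * ((a (i + 1) + c) * (φ (i + 2) + h (i + 2))) := by
      rw [hY]; ring
    rw [up, mid, main]
    rcases i with _ | k
    · simp only [zero_add, hΘ]
      generalize (if 1 < n then b 2 ^ 2 * (φ 3 + h 3) else 0) = w
      simp
      field_simp
      ring
    · have : (Pi.single (⟨0, by omega⟩ : Fin n) (1 : ℝ) : Fin n → ℝ) ⟨k + 1, hi⟩ = 0 := by
        rw [Pi.single_apply]; simp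
      simp only [Pi.smul_apply, this]
      simp only [Nat.le_add_left, if_true, Nat.add_sub_cancel, hY, hprod, smul_zero]
      ring
  have huniq := Matrix.mulVec_injective_of_isUnit
    ((Matrix.isUnit_iff_isUnit_det _).2 (isUnit_iff_ne_zero.2 hdet)) (hz.trans hsol.symm)
  intro i
  rw [huniq]
  exact hY i
end

section
/- Let H be a real Hilbert space and M : H → H a bounded self-adjoint operator. Suppose (s_j)_{j≥1} is a Hilbert basis of H consisting of eigenvectors of M with M s_j = λ_j s_j, where λ_1 ≥ λ_2 ≥ ⋯ ≥ 0 is nonincreasing, nonnegative, and tends to 0 as j → ∞. Let w ∈ H be nonzero, and suppose (u_i)_{i≥1} is an orthonormal sequence in H with u_1 = w/‖w‖ such that there exist reals d_i and c_i with c_i > 0 satisfying M u_1 = d_1 u_1 + c_2 u_2 and M u_i = c_i u_{i−1} + d_i u_i + c_{i+1} u_{i+1} for all i ≥ 2. Then the partial products of the off-diagonal Lanczos coefficients tend to zero: lim_{j→∞} ∏_{i=2}^{j} c_i = 0. -/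
/-- the partial products of the off-diagonal Lanczos coefficients tend to zero
when the eigenvalues of the bounded self-adjoint operator tend to zero. -/
theorem stmt_9 {H : Type*} [NormedAddCommGroup H] [InnerProductSpace ℝ H] [CompleteSpace H]
    (M : H →L[ℝ] H) (hM : IsSelfAdjoint M)
    (s : ℕ → H) (lam : ℕ → ℝ)
    (hs_on : Orthonormal ℝ (fun j : ℕ => s (j + 1)))
    (hs_dense : (Submodule.span ℝ (Set.range fun j : ℕ => s (j + 1))).topologicalClosure = ⊤)
    (heig : ∀ j, 1 ≤ j → M (s j) = lam j • s j)
    (hmono : ∀ j, 1 ≤ j → lam (j + 1) ≤ lam j)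
    (hnonneg : ∀ j, 1 ≤ j → 0 ≤ lam j)
    (hlim : Filter.Tendsto lam Filter.atTop (nhds 0))
    (w : H) (hw : w ≠ 0)
    (u : ℕ → H) (hu_on : Orthonormal ℝ (fun i : ℕ => u (i + 1)))
    (hu1 : u 1 = ‖w‖⁻¹ • w)
    (d c : ℕ → ℝ) (hc : ∀ i, 2 ≤ i → 0 < c i)
    (hrec1 : M (u 1) = d 1 • u 1 + c 2 • u 2)
    (hrec : ∀ i, 2 ≤ i → M (u i) = c i • u (i - 1) + d i • u i + c (i + 1) • u (i + 1)) :
    Filter.Tendsto (fun j : ℕ => ∏ i ∈ Finset.Icc 2 j, c i) Filter.atTop (nhds 0) := by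
  have hinner : ∀ x : H, Filter.Tendsto (fun n : ℕ => inner ℝ (u (n + 1)) x ^ 2)
      Filter.atTop (nhds 0) := by
    intro x
    have h := (hu_on.inner_products_summable x).tendsto_atTop_zero
    simpa using h
  have hsym : ∀ x y : H, inner ℝ (M x) y = inner ℝ x (M y) :=
    ContinuousLinearMap.isSelfAdjoint_iff_isSymmetric.mp hM
  let b : HilbertBasis ℕ ℝ H := HilbertBasis.mk hs_on hs_dense.ge
  have hb : ∀ j, b j = s (j + 1) := fun j => by simp [b]
  have hpars : ∀ x : H, HasSum (fun j : ℕ => inner ℝ x (s (j + 1)) ^ 2) (‖x‖ ^ 2) := by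
    intro x
    have h := b.hasSum_inner_mul_inner x x
    rw [real_inner_self_eq_norm_sq] at h
    refine h.congr_fun ?_ |> id
    intro j
    rw [hb, real_inner_comm x (s (j + 1)), sq]
  have hcoef : ∀ x : H, ∀ j : ℕ, inner ℝ (M x) (s (j + 1)) ^ 2
      = lam (j + 1) ^ 2 * inner ℝ x (s (j + 1)) ^ 2 := by
    intro x j
    rw [hsym, heig _ (by omega), inner_smul_right, mul_pow]
  have hMu : Filter.Tendsto (fun n : ℕ => ‖M (u (n + 1))‖ ^ 2) Filter.atTop (nhds 0) := by
    rw [Metric.tendsto_atTop]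
    intro ε hε
    have hl2 : Filter.Tendsto (fun j => lam (j + 1) ^ 2) Filter.atTop (nhds 0) := by
      simpa using ((Filter.tendsto_add_atTop_iff_nat 1).2 hlim).pow 2
    obtain ⟨N, hN⟩ := Filter.eventually_atTop.1 (hl2.eventually_lt_const (half_pos hε))
    have hfin : Filter.Tendsto (fun n : ℕ => ∑ j ∈ Finset.range N,
        lam (j + 1) ^ 2 * inner ℝ (u (n + 1)) (s (j + 1)) ^ 2) Filter.atTop (nhds 0) := by
      have := tendsto_finsetSum (Finset.range N)
        (fun j _ => (hinner (s (j + 1))).const_mul (lam (j + 1) ^ 2))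
      simpa using this
    obtain ⟨K, hK⟩ := Filter.eventually_atTop.1 (hfin.eventually_lt_const (half_pos hε))
    refine ⟨K, fun n hn => ?_⟩
    have h1 := hpars (M (u (n + 1)))
    have h2 := (hpars (u (n + 1))).mul_left (ε / 2)
    have h3 : HasSum (fun j => if j ∈ Finset.range N then
        lam (j + 1) ^ 2 * inner ℝ (u (n + 1)) (s (j + 1)) ^ 2 else 0)
        (∑ j ∈ Finset.range N, lam (j + 1) ^ 2 * inner ℝ (u (n + 1)) (s (j + 1)) ^ 2) := by
      rw [← Finset.sum_congr rfl (fun j hj => if_pos hj)]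
      exact hasSum_sum_of_ne_finset_zero (fun j hj => if_neg hj)
    have hle := hasSum_le (fun j => ?_) h1 (h3.add h2)
    · have hnorm : ‖u (n + 1)‖ = 1 := hu_on.1 n
      rw [hnorm] at hle
      rw [Real.dist_eq, sub_zero, abs_of_nonneg (sq_nonneg _)]
      linarith [hK n hn]
    · rw [hcoef]
      have hq := sq_nonneg (inner ℝ (u (n + 1)) (s (j + 1)))
      by_cases hj : j ∈ Finset.range N
      · rw [if_pos hj]
        nlinarith
      · rw [if_neg hj, zero_add]
        exact mul_le_mul_of_nonneg_right (hN j (by simpa using hj)).le hq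
  have hcle : ∀ n : ℕ, c (n + 3) ^ 2 ≤ ‖M (u (n + 1 + 1))‖ ^ 2 := by
    intro n
    have horth : ∀ i j : ℕ, i ≠ j → inner ℝ (u (i + 1)) (u (j + 1)) = 0 :=
      fun i j hij => hu_on.2 hij
    have hn1 : ‖u (n + 3)‖ = 1 := hu_on.1 (n + 2)
    have h : inner ℝ (M (u (n + 2))) (u (n + 3)) = c (n + 3) := by
      rw [hrec (n + 2) (by omega), inner_add_left, inner_add_left, inner_smul_left,
        inner_smul_left, inner_smul_left, real_inner_self_eq_norm_sq, hn1]
      have e1 : inner ℝ (u (n + 2 - 1)) (u (n + 3)) = 0 := horth n (n + 2) (by omega)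
      have e2 : inner ℝ (u (n + 2)) (u (n + 3)) = 0 := horth (n + 1) (n + 2) (by omega)
      rw [e1, e2]
      simp
    have h2 := real_inner_le_norm (M (u (n + 2))) (u (n + 3))
    rw [h, hn1, mul_one] at h2
    exact pow_le_pow_left₀ (hc _ (by omega)).le h2 2
  have hc0 : Filter.Tendsto c Filter.atTop (nhds 0) := by
    rw [← Filter.tendsto_add_atTop_iff_nat 3]
    have h := squeeze_zero (fun n => sq_nonneg _) hcle ((Filter.tendsto_add_atTop_iff_nat 1).2 hMu)
    have h' := h.sqrt
    rw [Real.sqrt_zero] at h'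
    refine h'.congr fun n => ?_
    exact Real.sqrt_sq (hc _ (by omega)).le
  have hpos : ∀ n : ℕ, 0 < ∏ i ∈ Finset.Icc 2 n, c i :=
    fun n => Finset.prod_pos fun i hi => hc i (Finset.mem_Icc.1 hi).1
  refine (summable_of_ratio_test_tendsto_lt_one (l := 0) one_pos
    (Filter.Eventually.of_forall fun n => (hpos n).ne') ?_).tendsto_atTop_zero
  refine ((Filter.tendsto_add_atTop_iff_nat 1).2 hc0).congr' ?_
  filter_upwards [Filter.eventually_ge_atTop 1] with n hn
  rw [Real.norm_of_nonneg (hpos _).le, Real.norm_of_nonneg (hpos _).le,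
    Finset.prod_Icc_succ_top (by omega), mul_div_cancel_left₀ _ (hpos n).ne']
end

section
/- Let X and Y be real Hilbert spaces, A : X → Y a bounded linear operator with adjoint A*, and y ∈ Y with A*y ≠ 0. Set b_1 = ‖A*y‖ and v_1 = A*y/b_1. Suppose vectors v_1,…,v_{m+1} ∈ X and reals a_1,…,a_m, b_2,…,b_{m+1} satisfy the Lanczos three-term recurrence A*A v_1 = a_1 v_1 + b_2 v_2 and A*A v_i = b_i v_{i−1} + a_i v_i + b_{i+1} v_{i+1} for 2 ≤ i ≤ m. Let T_m be the m×m symmetric tridiagonal matrix with diagonal a_1,…,a_m and off-diagonal b_2,…,b_m, assume det T_m ≠ 0, let z ∈ ℝ^m solve T_m z = b_1 e_1, and set x_m = ∑_{i=1}^m z_i v_i. Then the normal-equations residual satisfies A*(y − A x_m) = −b_1 b_{m+1} (T_m^{-1})_{m,1} v_{m+1}. -/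
/-- the normal-equations residual of the CG (Lanczos) iterate satisfies
`A*(y − A xₘ) = −b₁ b_{m+1} (Tₘ⁻¹)_{m,1} v_{m+1}`. -/
theorem stmt_11 {X Y : Type*}
    [NormedAddCommGroup X] [InnerProductSpace ℝ X] [CompleteSpace X]
    [NormedAddCommGroup Y] [InnerProductSpace ℝ Y] [CompleteSpace Y]
    (A : X →L[ℝ] Y) (y : Y) (hy : A.adjoint y ≠ 0)
    (m : ℕ) (hm : 1 ≤ m)
    (v : ℕ → X) (a b : ℕ → ℝ)
    (hb1 : b 1 = ‖A.adjoint y‖)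
    (hv1 : v 1 = (b 1)⁻¹ • A.adjoint y)
    (hrec1 : A.adjoint (A (v 1)) = a 1 • v 1 + b 2 • v 2)
    (hrec : ∀ i, 2 ≤ i → i ≤ m →
      A.adjoint (A (v i)) = b i • v (i - 1) + a i • v i + b (i + 1) • v (i + 1))
    (T : Matrix (Fin m) (Fin m) ℝ)
    (hT : ∀ i j : Fin m, T i j =
      if (i : ℕ) = (j : ℕ) then a ((i : ℕ) + 1)
      else if (i : ℕ) + 1 = (j : ℕ) then b ((j : ℕ) + 1)
      else if (j : ℕ) + 1 = (i : ℕ) then b ((i : ℕ) + 1)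
      else 0)
    (hdet : T.det ≠ 0)
    (z : Fin m → ℝ)
    (hz : T.mulVec z = b 1 • (Pi.single (⟨0, by omega⟩ : Fin m) (1 : ℝ) : Fin m → ℝ))
    (x : X) (hx : x = ∑ i : Fin m, z i • v ((i : ℕ) + 1)) :
    A.adjoint (y - A x) =
      -(b 1 * b (m + 1) * T⁻¹ (⟨m - 1, by omega⟩ : Fin m) (⟨0, by omega⟩ : Fin m)) •
        v (m + 1) := by
  obtain ⟨n, rfl⟩ : ∃ n, m = n + 1 := ⟨m - 1, by omega⟩
  have hb : b 1 ≠ 0 := by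
    rw [hb1]
    exact norm_ne_zero_iff.mpr hy
  have hy1 : A.adjoint y = b 1 • v 1 := by
    rw [hv1, smul_smul, mul_inv_cancel₀ hb, one_smul]
  have hzz : z = b 1 • (T⁻¹).mulVec (Pi.single (⟨0, by omega⟩ : Fin (n + 1)) (1 : ℝ)) := by
    rw [← Matrix.mulVec_smul, ← hz, Matrix.mulVec_mulVec,
      Matrix.nonsing_inv_mul _ (isUnit_iff_ne_zero.mpr hdet), Matrix.one_mulVec]
  have hzl : z (⟨n, by omega⟩ : Fin (n + 1))
      = b 1 * T⁻¹ (⟨n, by omega⟩ : Fin (n + 1)) (⟨0, by omega⟩ : Fin (n + 1)) := by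
    conv_lhs => rw [hzz]
    simp [Matrix.mulVec_single_one, Matrix.col_apply]
  have key : ∀ j : Fin (n + 1), A.adjoint (A (v ((j : ℕ) + 1))) =
      ∑ i : Fin (n + 1), T i j • v ((i : ℕ) + 1) +
        if j = (⟨n, by omega⟩ : Fin (n + 1)) then b (n + 2) • v (n + 2) else 0 := by
    rintro ⟨j, hj⟩
    have h1 : ∑ i : Fin (n + 1), T i ⟨j, hj⟩ • v ((i : ℕ) + 1)
        = ∑ i ∈ Finset.range (n + 1),
          ((if i = j then a (j + 1) • v (j + 1) else 0) +
           (if i = j + 1 then b (j + 2) • v (j + 2) else 0) +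
           (if i + 1 = j then b (j + 1) • v j else 0)) := by
      rw [← Fin.sum_univ_eq_sum_range (fun i =>
          ((if i = j then a (j + 1) • v (j + 1) else 0) +
           (if i = j + 1 then b (j + 2) • v (j + 2) else 0) +
           (if i + 1 = j then b (j + 1) • v j else 0)))]
      refine Finset.sum_congr rfl ?_
      rintro ⟨i, hi⟩ -
      rw [hT]
      dsimp only
      by_cases e1 : i = j
      · subst e1
        simp
      by_cases e2 : i + 1 = j
      · subst e2
        have : i ≠ i + 1 + 1 := by omega
        simp [this]
      by_cases e3 : j + 1 = i
      · subst e3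
        have : j + 1 + 1 ≠ j := by omega
        simp [this]
      · have : i ≠ j + 1 := by omega
        simp [e1, e2, e3, this]
    rw [h1, Finset.sum_add_distrib, Finset.sum_add_distrib, Finset.sum_ite_eq',
      Finset.sum_ite_eq', if_pos (Finset.mem_range.mpr hj)]
    have h2 : ((if j + 1 ∈ Finset.range (n + 1) then b (j + 2) • v (j + 2) else 0) : X)
        + (if (⟨j, hj⟩ : Fin (n + 1)) = ⟨n, by omega⟩ then b (n + 2) • v (n + 2) else 0)
        = b (j + 2) • v (j + 2) := by
      by_cases e : j = n
      · subst e
        simp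
      · have : j < n := by omega
        simp [e, this]
    dsimp only
    rcases j with _ | k
    · have h3 : ∑ i ∈ Finset.range (n + 1), (if i + 1 = 0 then b (0 + 1) • v 0 else (0 : X)) = 0 := by
        simp
      rw [h3, add_zero, add_assoc, h2]
      exact hrec1
    · have h3 : ∑ i ∈ Finset.range (n + 1),
          (if i + 1 = k + 1 then b (k + 1 + 1) • v (k + 1) else (0 : X))
          = b (k + 1 + 1) • v (k + 1) := by
        simp only [add_left_inj]
        rw [Finset.sum_ite_eq', if_pos (Finset.mem_range.mpr (by omega))]
      have h4 := hrec (k + 1 + 1) (by omega) (by omega)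
      rw [h3, add_right_comm _ (b (k + 1 + 1) • v (k + 1)), add_assoc (a _ • _), h2, h4]
      simp only [Nat.add_sub_cancel]
      abel
  have hAx : A.adjoint (A x) = b 1 • v 1 + z ⟨n, by omega⟩ • b (n + 2) • v (n + 2) := by
    rw [hx]
    simp only [map_sum, map_smul, key, smul_add, Finset.sum_add_distrib, smul_ite, smul_zero,
      Finset.sum_ite_eq', Finset.mem_univ, if_true, Finset.sum_ite_eq]
    congr 1
    simp only [Finset.smul_sum]
    rw [Finset.sum_comm]
    have h5 : ∀ i : Fin (n + 1), ∑ j : Fin (n + 1), z j • T i j • v ((i : ℕ) + 1)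
        = (T.mulVec z) i • v ((i : ℕ) + 1) := by
      intro i
      simp only [Matrix.mulVec, dotProduct, Finset.sum_smul, smul_smul, mul_comm]
    simp only [h5, hz]
    rw [Finset.sum_eq_single (⟨0, by omega⟩ : Fin (n + 1))]
    · simp
    · intro i _ hi
      rw [Pi.smul_apply, Pi.single_eq_of_ne hi, smul_zero, zero_smul]
    · simp
  rw [map_sub, hAx, hy1, hzl]
  simp only [Nat.add_sub_cancel, smul_smul, neg_smul]
  rw [sub_add_cancel_left]
  congr 2
  ring
end

section
/- Let X and Y be real Hilbert spaces, A : X → Y a bounded linear operator with adjoint A*, and y ∈ Y with A*y ≠ 0. Set b_1 = ‖A*y‖ and v_1 = A*y/b_1. Suppose vectors v_1,…,v_{m+1} ∈ X and reals a_1,…,a_m, b_2,…,b_{m+1} satisfy the Lanczos three-term recurrence A*A v_1 = a_1 v_1 + b_2 v_2 and A*A v_i = b_i v_{i−1} + a_i v_i + b_{i+1} v_{i+1} for 2 ≤ i ≤ m. Let T_m be the m×m symmetric tridiagonal matrix with diagonal a_1,…,a_m and off-diagonal b_2,…,b_m, and let θ_m = det T_m and g_m(c) be the associated shift quantities. Let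 c ∈ ℝ, assume θ_m ≠ 0 and θ_m + g_m(c) ≠ 0, let z solve T_m z = b_1 e_1 and z^{(c)} solve (T_m + cI) z^{(c)} = b_1 e_1, and set x_m = ∑_{i=1}^m z_i v_i and x_m^{(c)} = ∑_{i=1}^m z^{(c)}_i v_i. Then A*y − (A*A + c·Id_X) x_m^{(c)} = (θ_m / (θ_m + g_m(c))) · A*(y − A x_m). -/
lemma aux_rows (n : ℕ) (a b : ℕ → ℝ) (T : Matrix (Fin (n+1)) (Fin (n+1)) ℝ)
    (hT : ∀ i j : Fin (n+1), T i j =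
      if (i : ℕ) = (j : ℕ) then a ((i : ℕ) + 1)
      else if (i : ℕ) + 1 = (j : ℕ) then b ((j : ℕ) + 1)
      else if (j : ℕ) + 1 = (i : ℕ) then b ((i : ℕ) + 1)
      else 0)
    (Z : ℕ → ℝ) (hZ : ∀ k, n < k → Z k = 0) (i : Fin (n+1)) :
    T.mulVec (fun j => Z j) i = (if (i : ℕ) = 0 then 0 else b (i + 1) * Z (i - 1))
      + a (i + 1) * Z i + b (i + 2) * Z (i + 1) := by
  obtain ⟨i, hi⟩ := i
  simp only [Matrix.mulVec, dotProduct, hT]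
  rw [Fin.sum_univ_eq_sum_range (fun j => (if i = j then a (i + 1)
      else if i + 1 = j then b (j + 1)
      else if j + 1 = i then b (i + 1)
      else 0) * Z j) (n+1)]
  have h : ∀ j ∈ Finset.range (n+1), (if i = j then a (i + 1)
      else if i + 1 = j then b (j + 1)
      else if j + 1 = i then b (i + 1)
      else 0) * Z j = (if j = i - 1 then (if i = 0 then 0 else b (i + 1) * Z (i - 1)) else 0)
        + (if j = i then a (i + 1) * Z i else 0)
        + (if j = i + 1 then b (i + 2) * Z (i + 1) else 0) := by
    intro j _
    rcases Nat.lt_trichotomy j i with h | h | h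
    · by_cases h1 : j + 1 = i
      · subst h1; simp [show j + 1 + 1 ≠ j by omega, show j ≠ j + 1 + 1 by omega]
      · have : j ≠ i - 1 := by omega
        simp [this, h1, h.ne, h.ne', show i + 1 ≠ j by omega, show j ≠ i + 1 by omega]
    · subst h
      rcases j with _ | j <;> simp
    · by_cases h1 : j = i + 1
      · subst h1; simp; omega
      · simp [show i ≠ j by omega, show i + 1 ≠ j by omega, show j + 1 ≠ i by omega,
          show j ≠ i - 1 by omega, show j ≠ i by omega, h1]
  rw [Finset.sum_congr rfl h, Finset.sum_add_distrib, Finset.sum_add_distrib,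
    Finset.sum_ite_eq', Finset.sum_ite_eq', Finset.sum_ite_eq']
  rw [if_pos (Finset.mem_range.2 (by omega)), if_pos (Finset.mem_range.2 hi)]
  congr 1
  split_ifs with h2
  · rfl
  · rw [hZ (i+1) (by simpa using h2)]; simp

lemma aux_main {X : Type*} [AddCommGroup X] [Module ℝ X] (n : ℕ)
    (B : X →ₗ[ℝ] X) (v : ℕ → X) (a b : ℕ → ℝ)
    (hrec1 : B (v 1) = a 1 • v 1 + b 2 • v 2)
    (hrec : ∀ i, 2 ≤ i → i ≤ n + 1 →
      B (v i) = b i • v (i - 1) + a i • v i + b (i + 1) • v (i + 1))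
    (T : Matrix (Fin (n+1)) (Fin (n+1)) ℝ)
    (hT : ∀ i j : Fin (n+1), T i j =
      if (i : ℕ) = (j : ℕ) then a ((i : ℕ) + 1)
      else if (i : ℕ) + 1 = (j : ℕ) then b ((j : ℕ) + 1)
      else if (j : ℕ) + 1 = (i : ℕ) then b ((i : ℕ) + 1)
      else 0)
    (θ : ℕ → ℝ) (hθ0 : θ 0 = 1) (hθ1 : θ 1 = a 1)
    (hθ : ∀ ℓ, 2 ≤ ℓ → ℓ ≤ n + 1 → θ ℓ = a ℓ * θ (ℓ - 1) - (b ℓ) ^ 2 * θ (ℓ - 2))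
    (z : Fin (n+1) → ℝ)
    (hz : T.mulVec z = b 1 • (Pi.single (0 : Fin (n+1)) (1 : ℝ) : Fin (n+1) → ℝ)) :
    ∃ t : ℝ, b 1 • v 1 - B (∑ i : Fin (n+1), z i • v ((i : ℕ) + 1)) =
        -(t * b (n + 2)) • v (n + 2) ∧
      θ (n + 1) * t = (-1) ^ n * ∏ i ∈ Finset.range (n + 1), b (i + 1) := by
  obtain ⟨Z, hZz, hZ⟩ : ∃ Z : ℕ → ℝ, (z = fun j : Fin (n+1) => Z j) ∧ ∀ k, n < k → Z k = 0 := by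
    refine ⟨fun k => if h : k < n + 1 then z ⟨k, h⟩ else 0, ?_, ?_⟩
    · funext j; simp only [j.isLt, dite_true]
    · intro k hk; simp; intro h; omega
  subst hZz
  have rows := aux_rows n a b T hT Z hZ
  rw [hz] at rows
  have r0 : b 1 = a 1 * Z 0 + b 2 * Z 1 := by
    simpa using rows 0
  have rs : ∀ k, k + 1 ≤ n → 0 = b (k+2) * Z k + a (k+2) * Z (k+1) + b (k+3) * Z (k+2) := by
    intro k hk
    have := rows ⟨k+1, by omega⟩
    simpa [Pi.single_apply, Fin.ext_iff] using this
  have key : ∀ k, k ≤ n → θ (k+1) * Z k + θ k * (b (k+2) * Z (k+1)) =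
      (-1) ^ k * ∏ i ∈ Finset.range (k + 1), b (i + 1) := by
    intro k
    induction k with
    | zero => intro _; simp [hθ0, hθ1, r0]
    | succ k ih =>
      intro hk
      have h1 := ih (by omega)
      have h2 := hθ (k+2) (by omega) (by omega)
      have h3 := rs k hk
      simp only [show k + 2 - 1 = k + 1 by omega, show k + 2 - 2 = k by omega] at h2
      rw [Finset.prod_range_succ, pow_succ]
      simp only [show k + 1 + 1 = k + 2 by omega, show k + 1 + 2 = k + 3 by omega] 
      rw [h2]
      linear_combination (-b (k+2)) * h1 - θ (k+1) * h3
  have key2 : ∀ k, k ≤ n → b 1 • v 1 - B (∑ i ∈ Finset.range (k+1), Z i • v (i + 1)) =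
      (b (k+2) * Z (k+1)) • v (k+1) - (b (k+2) * Z k) • v (k+2) := by
    intro k
    induction k with
    | zero =>
      intro _
      simp only [zero_add, Finset.sum_range_one, map_smul, hrec1]
      rw [r0]; module
    | succ k ih =>
      intro hk
      have h3 := rs k hk
      rw [Finset.sum_range_succ, map_add, ← sub_sub, ih (by omega), map_smul,
        hrec (k+1+1) (by omega) (by omega)]
      simp only [show k + 1 + 1 = k + 2 by omega, show k + 1 + 2 = k + 3 by omega,
        show k + 2 - 1 = k + 1 by omega, show k + 2 + 1 = k + 3 by omega]
      have h4 : b (k+3) * Z (k+2) = - (b (k+2) * Z k) - a (k+2) * Z (k+1) := by linarith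
      rw [h4]; module
  refine ⟨Z n, ?_, ?_⟩
  · have := key2 n le_rfl
    rw [Fin.sum_univ_eq_sum_range (fun i => Z i • v (i + 1)) (n+1), this, hZ (n+1) (by omega)]
    module
  · have := key n le_rfl
    rw [hZ (n+1) (by omega)] at this
    linarith

/-- relation between the CG and CGT residuals,
`A*y − (A*A + c·Id) xₘ⁽ᶜ⁾ = (θₘ / (θₘ + gₘ(c))) · A*(y − A xₘ)`. -/
theorem stmt_13 {X Y : Type*}
    [NormedAddCommGroup X] [InnerProductSpace ℝ X] [CompleteSpace X]
    [NormedAddCommGroup Y] [InnerProductSpace ℝ Y] [CompleteSpace Y]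
    (A : X →L[ℝ] Y) (y : Y) (hy : A.adjoint y ≠ 0)
    (m : ℕ) (hm : 1 ≤ m) (c : ℝ)
    (v : ℕ → X) (a b : ℕ → ℝ)
    (hb1 : b 1 = ‖A.adjoint y‖)
    (hv1 : v 1 = (b 1)⁻¹ • A.adjoint y)
    (hrec1 : A.adjoint (A (v 1)) = a 1 • v 1 + b 2 • v 2)
    (hrec : ∀ i, 2 ≤ i → i ≤ m →
      A.adjoint (A (v i)) = b i • v (i - 1) + a i • v i + b (i + 1) • v (i + 1))
    (T : Matrix (Fin m) (Fin m) ℝ)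
    (hT : ∀ i j : Fin m, T i j =
      if (i : ℕ) = (j : ℕ) then a ((i : ℕ) + 1)
      else if (i : ℕ) + 1 = (j : ℕ) then b ((j : ℕ) + 1)
      else if (j : ℕ) + 1 = (i : ℕ) then b ((i : ℕ) + 1)
      else 0)
    (θ : ℕ → ℝ) (hθ0 : θ 0 = 1) (hθ1 : θ 1 = a 1)
    (hθ : ∀ ℓ, 2 ≤ ℓ → ℓ ≤ m → θ ℓ = a ℓ * θ (ℓ - 1) - (b ℓ) ^ 2 * θ (ℓ - 2))
    (g : ℕ → ℝ) (hg0 : g 0 = 0) (hg1 : g 1 = c)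
    (hg : ∀ ℓ, 2 ≤ ℓ → ℓ ≤ m →
      g ℓ = (a ℓ + c) * g (ℓ - 1) - (b ℓ) ^ 2 * g (ℓ - 2) + c * θ (ℓ - 1))
    (hθm : θ m ≠ 0) (hθgm : θ m + g m ≠ 0)
    (z : Fin m → ℝ)
    (hz : T.mulVec z = b 1 • (Pi.single (⟨0, by omega⟩ : Fin m) (1 : ℝ) : Fin m → ℝ))
    (zc : Fin m → ℝ)
    (hzc : (T + c • (1 : Matrix (Fin m) (Fin m) ℝ)).mulVec zc =
      b 1 • (Pi.single (⟨0, by omega⟩ : Fin m) (1 : ℝ) : Fin m → ℝ))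
    (x : X) (hx : x = ∑ i : Fin m, z i • v ((i : ℕ) + 1))
    (xc : X) (hxc : xc = ∑ i : Fin m, zc i • v ((i : ℕ) + 1)) :
    A.adjoint y - (A.adjoint (A xc) + c • xc) =
      (θ m / (θ m + g m)) • A.adjoint (y - A x) := by

  obtain ⟨n, rfl⟩ : ∃ n, m = n + 1 := ⟨m - 1, by omega⟩
  have hb : b 1 ≠ 0 := by rw [hb1]; exact norm_ne_zero_iff.2 hy
  have hw : b 1 • v 1 = A.adjoint y := by rw [hv1, smul_inv_smul₀ hb]
  obtain ⟨t, ht1, ht2⟩ := aux_main n (A.adjoint ∘L A : X →L[ℝ] X).toLinearMap v a b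
    (by simpa using hrec1) (by simpa using hrec) T hT θ hθ0 hθ1 hθ z hz
  obtain ⟨s, hs1, hs2⟩ := aux_main n
    ((A.adjoint ∘L A : X →L[ℝ] X).toLinearMap + c • LinearMap.id) v (fun i => a i + c) b
    (by
      have : A.adjoint (A (v 1)) + c • v 1 = (a 1 + c) • v 1 + b 2 • v 2 := by
        rw [hrec1]; module
      simpa using this)
    (by
      intro i h1 h2
      have : A.adjoint (A (v i)) + c • v i
          = b i • v (i - 1) + (a i + c) • v i + b (i + 1) • v (i + 1) := by
        rw [hrec i h1 h2]; module
      simpa using this)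
    (T + c • (1 : Matrix (Fin (n+1)) (Fin (n+1)) ℝ))
    (by
      intro i j
      rw [Matrix.add_apply, Matrix.smul_apply, Matrix.one_apply, hT]
      by_cases h : (i : ℕ) = j
      · simp [h, Fin.ext_iff]
      · simp [h, Fin.ext_iff])
    (fun k => θ k + g k) (by simp [hθ0, hg0]) (by simp [hθ1, hg1])
    (by
      intro l h1 h2
      simp only [hθ l h1 h2, hg l h1 h2]; ring) zc hzc
  rw [← hx, hw] at ht1
  rw [← hxc, hw] at hs1
  have e1 : A.adjoint y - (A.adjoint (A xc) + c • xc) = -(s * b (n + 2)) • v (n + 2) := by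
    simpa using hs1
  have e2 : A.adjoint (y - A x) = -(t * b (n + 2)) • v (n + 2) := by
    rw [map_sub]; simpa using ht1
  have hst : s = θ (n+1) / (θ (n+1) + g (n+1)) * t := by
    field_simp
    linarith
  rw [e1, e2, smul_smul]
  congr 1
  rw [hst]; ring
end

section
/- Let T be an n×n real symmetric tridiagonal matrix with diagonal entries a_1,…,a_n and off-diagonal entries b_2,…,b_n, let m ≥ 1 with m + 2 ≤ n, and let p ∈ ℝ[X] be a monic polynomial of degree m. Then the (m+1, 1) entry of the matrix p(T) equals the product of the first m subdiagonal entries: (p(T))_{m+1,1} = ∏_{k=2}^{m+1} b_k. -/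
theorem aux_zero (n : ℕ) (T : Matrix (Fin n) (Fin n) ℝ)
    (hT : ∀ i j : Fin n, (j : ℕ) + 1 < (i : ℕ) → T i j = 0) (z : Fin n) (hz : (z : ℕ) = 0)
    (k : ℕ) : ∀ i : Fin n, k < (i : ℕ) → (T ^ k) i z = 0 := by
  induction k with
  | zero =>
    intro i hi
    rw [pow_zero, Matrix.one_apply_ne]
    rintro rfl
    omega
  | succ k ih =>
    intro i hi
    rw [pow_succ', Matrix.mul_apply]
    refine Finset.sum_eq_zero fun j _ => ?_
    by_cases hj : (j : ℕ) + 1 < (i : ℕ)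
    · rw [hT i j hj, zero_mul]
    · rw [ih j (by omega), mul_zero]

theorem aux_prod (n : ℕ) (b : ℕ → ℝ) (T : Matrix (Fin n) (Fin n) ℝ)
    (hT : ∀ i j : Fin n, (j : ℕ) + 1 < (i : ℕ) → T i j = 0)
    (hb : ∀ i j : Fin n, (j : ℕ) + 1 = (i : ℕ) → T i j = b ((i : ℕ) + 1))
    (z : Fin n) (hz : (z : ℕ) = 0)
    (k : ℕ) : ∀ i : Fin n, (i : ℕ) = k → (T ^ k) i z = ∏ k ∈ Finset.Icc 2 (k + 1), b k := by
  induction k with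
  | zero =>
    intro i hi
    have : i = z := Fin.ext (by omega)
    subst this
    simp
  | succ k ih =>
    intro i hi
    rw [pow_succ', Matrix.mul_apply]
    rw [Finset.sum_eq_single (⟨k, by omega⟩ : Fin n)]
    · rw [ih _ rfl, hb i _ (by simp [hi]), Finset.prod_Icc_succ_top (b := k + 1) (by omega), mul_comm, hi]
    · intro j _ hj
      have hj' : (j : ℕ) ≠ k := fun h => hj (Fin.ext h)
      by_cases h : (j : ℕ) + 1 < (i : ℕ)
      · rw [hT i j h, zero_mul]
      · rw [aux_zero n T hT z hz k j (by omega), mul_zero]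
    · simp

/-- for a monic polynomial `p` of degree `m`, the `(m+1, 1)` entry of `p(T)`
(1-indexed) equals the product of the first `m` subdiagonal entries of the tridiagonal `T`. -/
theorem stmt_16 (n : ℕ) (a b : ℕ → ℝ)
    (T : Matrix (Fin n) (Fin n) ℝ)
    (hT : ∀ i j : Fin n, T i j =
      if (i : ℕ) = (j : ℕ) then a ((i : ℕ) + 1)
      else if (i : ℕ) + 1 = (j : ℕ) then b ((j : ℕ) + 1)
      else if (j : ℕ) + 1 = (i : ℕ) then b ((i : ℕ) + 1)
      else 0)
    (m : ℕ) (hm : 1 ≤ m) (hmn : m + 2 ≤ n)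
    (p : Polynomial ℝ) (hmonic : p.Monic) (hdeg : p.natDegree = m) :
    Polynomial.aeval T p (⟨m, by omega⟩ : Fin n) (⟨0, by omega⟩ : Fin n) =
      ∏ k ∈ Finset.Icc 2 (m + 1), b k := by
  have h0 : ∀ i j : Fin n, (j : ℕ) + 1 < (i : ℕ) → T i j = 0 := by
    intro i j h
    rw [hT, if_neg (by omega), if_neg (by omega), if_neg (by omega)]
  have hb : ∀ i j : Fin n, (j : ℕ) + 1 = (i : ℕ) → T i j = b ((i : ℕ) + 1) := by
    intro i j h
    rw [hT, if_neg (by omega), if_neg (by omega), if_pos h]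
  rw [Polynomial.aeval_eq_sum_range, Matrix.sum_apply, hdeg, Finset.sum_range_succ,
    Finset.sum_eq_zero, zero_add, Matrix.smul_apply, aux_prod n b T h0 hb _ rfl m _ rfl]
  · have : p.coeff m = 1 := by rw [← hdeg]; exact hmonic
    rw [this, one_smul]
  · intro k hk
    rw [Matrix.smul_apply, aux_zero n T h0 _ rfl k _ (Finset.mem_range.mp hk), smul_zero]
end

section
/- Let H be a real Hilbert space and M : H → H a bounded self-adjoint operator. Suppose (s_j)_{j≥1} is a Hilbert basis of H consisting of eigenvectors of M with M s_j = λ_j s_j, where λ_1 ≥ λ_2 ≥ ⋯ ≥ 0 is nonincreasing and nonnegative. For m ≥ 1 let p_m(t) = ∏_{i=1}^{m} (t − λ_i) be the monic polynomial with roots at the first m eigenvalues. Then for every x ∈ H, ‖p_m(M) x‖ ≤ (∏_{i=1}^{m} λ_i) · ‖x‖. -/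
theorem aux_eig {H : Type*} [NormedAddCommGroup H] [InnerProductSpace ℝ H]
    (M : H →L[ℝ] H) (v : H) (a : ℝ) (h : M v = a • v) (p : Polynomial ℝ) :
    (Polynomial.aeval M p) v = p.eval a • v := by
  induction p using Polynomial.induction_on' with
  | add p q hp hq => simp [hp, hq, add_smul]
  | monomial n c =>
    have hn : (M ^ n) v = a ^ n • v := by
      induction n with
      | zero => simp
      | succ n ih =>
        rw [pow_succ', ContinuousLinearMap.mul_apply, ih, map_smul, h, smul_smul, pow_succ]
    rw [Polynomial.aeval_monomial, ContinuousLinearMap.mul_apply, hn, Polynomial.eval_monomial,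
      Algebra.algebraMap_eq_smul_one, ContinuousLinearMap.smul_apply,
      ContinuousLinearMap.one_apply, smul_smul]

theorem aux_bound {H : Type*} [NormedAddCommGroup H] [InnerProductSpace ℝ H]
    (T : H →L[ℝ] H) (v : ℕ → H) (mu : ℕ → ℝ) (C : ℝ) (hC : 0 ≤ C)
    (hv : Orthonormal ℝ v)
    (hd : (Submodule.span ℝ (Set.range v)).topologicalClosure = ⊤)
    (hT : ∀ j, T (v j) = mu j • v j) (hmu : ∀ j, |mu j| ≤ C) (x : H) :
    ‖T x‖ ≤ C * ‖x‖ := by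
  have hx : x ∈ closure (Submodule.span ℝ (Set.range v) : Set H) := by
    rw [← Submodule.topologicalClosure_coe, hd]; trivial
  have hcl : IsClosed {y : H | ‖T y‖ ≤ C * ‖y‖} :=
    isClosed_le (by fun_prop) (by fun_prop)
  refine closure_minimal ?_ hcl hx
  intro y hy
  obtain ⟨c, rfl⟩ := (Finsupp.mem_span_range_iff_exists_finsupp).1 hy
  rw [Set.mem_setOf_eq, Finsupp.sum]
  have hTs : T (∑ i ∈ c.support, c i • v i) = ∑ i ∈ c.support, (c i * mu i) • v i := by
    simp [map_sum, hT, smul_smul]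
  rw [hTs]
  refine (sq_le_sq₀ (norm_nonneg _) (by positivity)).1 ?_
  rw [mul_pow, ← real_inner_self_eq_norm_sq, ← real_inner_self_eq_norm_sq, hv.inner_sum,
    hv.inner_sum, Finset.mul_sum]
  refine Finset.sum_le_sum fun i _ => ?_
  have h1 : mu i ^ 2 ≤ C ^ 2 := sq_le_sq' (neg_le_of_abs_le (hmu i)) (le_of_abs_le (hmu i))
  simp only [conj_trivial]
  nlinarith [mul_le_mul_of_nonneg_right h1 (sq_nonneg (c i))]

/-- for a bounded self-adjoint operator with a Hilbert basis of eigenvectors and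
nonincreasing nonnegative eigenvalues, the monic polynomial `p_m(t) = ∏_{i=1}^m (t − λᵢ)` with
roots at the first `m` eigenvalues satisfies `‖p_m(M) x‖ ≤ (∏_{i=1}^m λᵢ) ‖x‖`. -/
theorem stmt_19 {H : Type*} [NormedAddCommGroup H] [InnerProductSpace ℝ H] [CompleteSpace H]
    (M : H →L[ℝ] H) (hM : IsSelfAdjoint M)
    (s : ℕ → H) (lam : ℕ → ℝ)
    (hs_on : Orthonormal ℝ (fun j : ℕ => s (j + 1)))
    (hs_dense : (Submodule.span ℝ (Set.range fun j : ℕ => s (j + 1))).topologicalClosure = ⊤)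
    (heig : ∀ j, 1 ≤ j → M (s j) = lam j • s j)
    (hmono : ∀ j, 1 ≤ j → lam (j + 1) ≤ lam j)
    (hnonneg : ∀ j, 1 ≤ j → 0 ≤ lam j)
    (m : ℕ) (hm : 1 ≤ m) (x : H) :
    ‖(Polynomial.aeval M
        (∏ i ∈ Finset.Icc 1 m, (Polynomial.X - Polynomial.C (lam i)))) x‖ ≤
      (∏ i ∈ Finset.Icc 1 m, lam i) * ‖x‖ := by
  have hanti : ∀ i j, 1 ≤ i → i ≤ j → lam j ≤ lam i := by
    intro i j hi hij
    induction j, hij using Nat.le_induction with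
    | base => exact le_rfl
    | succ k hk ih => exact (hmono k (hi.trans hk)).trans ih
  have hC : 0 ≤ ∏ i ∈ Finset.Icc 1 m, lam i :=
    Finset.prod_nonneg fun i hi => hnonneg i (Finset.mem_Icc.1 hi).1
  refine aux_bound _ (fun j => s (j + 1)) (fun j => Polynomial.eval (lam (j + 1))
    (∏ i ∈ Finset.Icc 1 m, (Polynomial.X - Polynomial.C (lam i)))) _ hC hs_on hs_dense
    (fun j => aux_eig M _ _ (heig (j + 1) (by omega)) _) (fun j => ?_) x
  simp only [Polynomial.eval_prod, Polynomial.eval_sub, Polynomial.eval_X, Polynomial.eval_C]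
  by_cases hj : j + 1 ≤ m
  · rw [Finset.prod_eq_zero (i := j + 1) (Finset.mem_Icc.2 ⟨by omega, hj⟩) (sub_self _), abs_zero]
    exact hC
  · rw [Finset.abs_prod]
    refine Finset.prod_le_prod (fun _ _ => abs_nonneg _) fun i hi => ?_
    have hi' := Finset.mem_Icc.1 hi
    have h1 := hanti i (j + 1) hi'.1 (by omega)
    have h2 := hnonneg (j + 1) (by omega)
    rw [abs_le]
    constructor <;> linarith
end
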